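/- arXiv:2508.10375 — 4 statements merged into one kernel-verified Lean document; each statement's English description precedes it below -/
import Mathlib

section
/- Let n ≥ 4 be an integer and let β be a bivariate sequence of degree 2n such that M_n(β) is positive semidefinite and (y−x⁴)-pure (take d = 4). For integers p ≥ 0 with (p mod 4) + ⌊p/4⌋ ≤ 2n set γ_p := β_{p mod 4, ⌊p/4⌋} (this defines γ_p for all 0 ≤ p ≤ 8n except p ∈ {8n−5, 8n−2, 8n−1}). Define C₂ := (γ_{p+q})_{0 ≤ p,q ≤ 4n−3} and C₃ := (γ_{p+q})_{p,q ∈ {0,…,4n−4} ∪ {4n−2}}. If β admits a representing measure, then C₂ is positive definite and C₃ is positive semidefinite. -/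
open MeasureTheory Matrix

noncomputable section

/-- Index set for the moment matrix `M_n(β)`: pairs `(i,j)` with `i + j ≤ n`. -/
abbrev MomIdx (n : ℕ) : Type :=
  {p : Fin (n + 1) × Fin (n + 1) // (p.1 : ℕ) + (p.2 : ℕ) ≤ n}

/-- Index set for the compressed moment matrix `M̂_n(β)`: pairs `(i,j)` with
`i + j ≤ n` and `i ≤ d − 1`. -/
abbrev MomIdxHat (n d : ℕ) : Type :=
  {p : Fin (n + 1) × Fin (n + 1) // (p.1 : ℕ) + (p.2 : ℕ) ≤ n ∧ (p.1 : ℕ) < d}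

/-- The moment matrix `M_n(β)`, with entry `β_{i+k, j+l}` in row `(i,j)`,
column `(k,l)`. -/
def momentMatrix (n : ℕ) (β : ℕ → ℕ → ℝ) : Matrix (MomIdx n) (MomIdx n) ℝ :=
  Matrix.of fun p q => β ((p.1.1 : ℕ) + (q.1.1 : ℕ)) ((p.1.2 : ℕ) + (q.1.2 : ℕ))

/-- The compressed moment matrix `M̂_n(β)` (rows and columns `(i,j)` with `i ≤ d−1`). -/
def momentMatrixHat (n d : ℕ) (β : ℕ → ℕ → ℝ) :
    Matrix (MomIdxHat n d) (MomIdxHat n d) ℝ :=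
  Matrix.of fun p q => β ((p.1.1 : ℕ) + (q.1.1 : ℕ)) ((p.1.2 : ℕ) + (q.1.2 : ℕ))

/-- `β` is a bivariate sequence of degree `2n` such that `M_n(β)` is positive
semidefinite and `(y − x^d)`-pure: `β_{00} = 1`, `β` satisfies the `(y − x^d)`
column relations, `M_n(β)` is positive semidefinite, and `M̂_n(β)` is positive
definite. -/
def IsPure (n d : ℕ) (β : ℕ → ℕ → ℝ) : Prop :=
  β 0 0 = 1 ∧
  (∀ i j : ℕ, i + j + d ≤ 2 * n → β (i + d) j = β i (j + 1)) ∧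
  (momentMatrix n β).PosSemidef ∧
  (momentMatrixHat n d β).PosDef

/-- `μ` is a representing measure for the bivariate sequence `β` of degree `2n`. -/
def IsRepMeasure (n : ℕ) (β : ℕ → ℕ → ℝ) (μ : Measure (ℝ × ℝ)) : Prop :=
  ∀ i j : ℕ, i + j ≤ 2 * n →
    Integrable (fun p : ℝ × ℝ => p.1 ^ i * p.2 ^ j) μ ∧
    (∫ p : ℝ × ℝ, p.1 ^ i * p.2 ^ j ∂μ) = β i j

/-- For `d = 4`: the univariate sequence `γ_p = β_{p mod 4, ⌊p/4⌋}`. -/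
def gamma4 (β : ℕ → ℕ → ℝ) (p : ℕ) : ℝ := β (p % 4) (p / 4)

/-- The Hankel matrix `C₂ = (γ_{p+q})_{0 ≤ p,q ≤ 4n−3}`. -/
def C2mat (n : ℕ) (β : ℕ → ℕ → ℝ) : Matrix (Fin (4 * n - 2)) (Fin (4 * n - 2)) ℝ :=
  Matrix.of fun p q => gamma4 β ((p : ℕ) + (q : ℕ))

/-- Index set `{0,…,4n−4} ∪ {4n−2}` for the matrix `C₃`. -/
abbrev C3Idx (n : ℕ) : Type := {m : Fin (4 * n - 1) // (m : ℕ) ≠ 4 * n - 3}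

/-- The matrix `C₃ = (γ_{p+q})_{p,q ∈ {0,…,4n−4} ∪ {4n−2}}`. -/
def C3mat (n : ℕ) (β : ℕ → ℕ → ℝ) : Matrix (C3Idx n) (C3Idx n) ℝ :=
  Matrix.of fun p q => gamma4 β ((p.1 : ℕ) + (q.1 : ℕ))

lemma sq_sum_mul_eq {ι : Type*} [Fintype ι] (x a : ι → ℝ) :
    (∑ i, x i * a i) ^ 2 = ∑ i, ∑ j, x i * x j * (a i * a j) := by
  rw [sq, Finset.sum_mul_sum]
  exact Finset.sum_congr rfl fun i _ => Finset.sum_congr rfl fun j _ => by ring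

/-- `A` is the Gram matrix of the functions `f i` in `L²(μ)`. -/
def IsGramMatrix {Ω ι : Type*} [MeasurableSpace Ω] (μ : Measure Ω) (f : ι → Ω → ℝ)
    (A : Matrix ι ι ℝ) : Prop :=
  ∀ i j, Integrable (fun ω => f i ω * f j ω) μ ∧ ∫ ω, f i ω * f j ω ∂μ = A i j

namespace IsGramMatrix

variable {Ω ι : Type*} [MeasurableSpace Ω] {μ : Measure Ω} {f : ι → Ω → ℝ}
  {A : Matrix ι ι ℝ}

lemma isHermitian (h : IsGramMatrix μ f A) : A.IsHermitian := by
  ext i j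
  rw [conjTranspose_apply, star_trivial, ← (h j i).2, ← (h i j).2]
  simp only [mul_comm]

variable [Fintype ι]

lemma integrable_sq (h : IsGramMatrix μ f A) (x : ι → ℝ) :
    Integrable (fun ω => (∑ i, x i * f i ω) ^ 2) μ := by
  simp only [sq_sum_mul_eq]
  exact integrable_finsetSum _ fun i _ => integrable_finsetSum _ fun j _ =>
    (h i j).1.const_mul _

lemma dotProduct_mulVec (h : IsGramMatrix μ f A) (x : ι → ℝ) :
    star x ⬝ᵥ (A *ᵥ x) = ∫ ω, (∑ i, x i * f i ω) ^ 2 ∂μ := by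
  simp only [sq_sum_mul_eq]
  rw [integral_finsetSum _ fun i _ => integrable_finsetSum _ fun j _ => (h i j).1.const_mul _]
  refine Finset.sum_congr rfl fun i _ => ?_
  rw [integral_finsetSum _ fun j _ => (h i j).1.const_mul _, mulVec, dotProduct,
    Finset.mul_sum]
  refine Finset.sum_congr rfl fun j _ => ?_
  rw [integral_const_mul, (h i j).2, star_trivial]
  ring

lemma posSemidef (h : IsGramMatrix μ f A) : A.PosSemidef :=
  .of_dotProduct_mulVec_nonneg h.isHermitian fun x => by
    rw [h.dotProduct_mulVec]
    exact integral_nonneg fun ω => sq_nonneg _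

/-- The Gram matrix of a family without nontrivial a.e. linear relations is positive definite. -/
lemma posDef (h : IsGramMatrix μ f A)
    (hf : ∀ x : ι → ℝ, (∀ᵐ ω ∂μ, ∑ i, x i * f i ω = 0) → x = 0) : A.PosDef := by
  refine .of_dotProduct_mulVec_pos h.isHermitian fun x hx => ?_
  refine (h.posSemidef.dotProduct_mulVec_nonneg x).lt_of_ne fun h0 => hx (hf x ?_)
  rw [h.dotProduct_mulVec, eq_comm,
    integral_eq_zero_iff_of_nonneg (fun ω => sq_nonneg _) (h.integrable_sq x)] at h0
  filter_upwards [h0] with ω hω using by simpa using hω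

/-- A positive definite Gram matrix forces the family to have no a.e. linear relations. -/
lemma eq_zero_of_posDef (h : IsGramMatrix μ f A) (hA : A.PosDef) {x : ι → ℝ}
    (hx : ∀ᵐ ω ∂μ, ∑ i, x i * f i ω = 0) : x = 0 := by
  by_contra hne
  have hpos := hA.dotProduct_mulVec_pos hne
  rw [h.dotProduct_mulVec, integral_eq_zero_of_ae] at hpos
  · exact lt_irrefl _ hpos
  · filter_upwards [hx] with ω hω using by simp [hω]

end IsGramMatrix

/-- Fewer points than functions: some nontrivial combination vanishes on all the points. -/
lemma exists_ne_zero_sum_mul_eq_zero {ι Ω : Type*} [Fintype ι] (f : ι → Ω → ℝ) (s : Finset Ω)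
    (h : s.card < Fintype.card ι) :
    ∃ x : ι → ℝ, x ≠ 0 ∧ ∀ ω ∈ s, ∑ i, x i * f i ω = 0 := by
  let F : (ι → ℝ) →ₗ[ℝ] (s → ℝ) := Matrix.mulVecLin (Matrix.of fun ω i => f i ω)
  have hF : LinearMap.ker F ≠ ⊥ := LinearMap.ker_ne_bot_of_finrank_lt (by simpa using h)
  obtain ⟨x, hx, hne⟩ := Submodule.exists_mem_ne_zero_of_ne_bot hF
  refine ⟨x, hne, fun ω hω => ?_⟩
  have := congrFun (LinearMap.mem_ker.1 hx) ⟨ω, hω⟩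
  simpa [F, mulVec, dotProduct, mul_comm] using this

lemma le_card_momIdxHat_four (n : ℕ) (hn : 2 ≤ n) :
    4 * n - 2 ≤ Fintype.card (MomIdxHat n 4) := by
  let g : Fin (n + 1) ⊕ Fin n ⊕ Fin (n - 1) ⊕ Fin (n - 2) → ℕ × ℕ :=
    Sum.elim (fun j => (0, j)) <| Sum.elim (fun j => (1, j)) <|
      Sum.elim (fun j => (2, j)) (fun j => (3, j))
  have hg : ∀ s, (g s).1 + (g s).2 ≤ n ∧ (g s).1 < 4 := by
    rintro (j | j | j | j) <;> simp only [g, Sum.elim_inl, Sum.elim_inr] <;> omega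
  have hinj : Function.Injective g := by
    rintro (j | j | j | j) (k | k | k | k) h <;>
      simp_all [g, Prod.ext_iff, Fin.ext_iff]
  refine le_trans ?_ (Fintype.card_le_of_injective
    (fun s => (⟨(⟨(g s).1, by have := hg s; omega⟩, ⟨(g s).2, by have := hg s; omega⟩), hg s⟩ :
      MomIdxHat n 4))
    fun s t h => hinj (by simpa [Prod.ext_iff] using h))
  simp only [Fintype.card_sum, Fintype.card_fin]
  omega

namespace IsRepMeasure

variable {n : ℕ} {β : ℕ → ℕ → ℝ} {μ : Measure (ℝ × ℝ)}

lemma isGramMatrix_momentMatrixHat (hμ : IsRepMeasure n β μ) (d : ℕ) :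
    IsGramMatrix μ (fun (k : MomIdxHat n d) p => p.1 ^ (k.1.1 : ℕ) * p.2 ^ (k.1.2 : ℕ))
      (momentMatrixHat n d β) := by
  intro k l
  have h := hμ (k.1.1 + l.1.1) (k.1.2 + l.1.2) (by have := k.2.1; have := l.2.1; omega)
  have e (p : ℝ × ℝ) : p.1 ^ (k.1.1 : ℕ) * p.2 ^ (k.1.2 : ℕ) *
      (p.1 ^ (l.1.1 : ℕ) * p.2 ^ (l.1.2 : ℕ)) =
      p.1 ^ ((k.1.1 : ℕ) + l.1.1) * p.2 ^ ((k.1.2 : ℕ) + l.1.2) := by ring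
  simpa only [e, momentMatrixHat, of_apply] using h

/-- The column relations put the measure on the curve `y = x⁴`. -/
lemma ae_snd_eq_fst_pow_four (hμ : IsRepMeasure n β μ) (hn : 4 ≤ n)
    (hcol : ∀ i j : ℕ, i + j + 4 ≤ 2 * n → β (i + 4) j = β i (j + 1)) :
    ∀ᵐ p ∂μ, p.2 = p.1 ^ 4 := by
  have h02 := hμ 0 2 (by omega)
  have h41 := hμ 4 1 (by omega)
  have h80 := hμ 8 0 (by omega)
  have e : (fun p : ℝ × ℝ => (p.2 - p.1 ^ 4) ^ 2) = fun p =>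
      p.1 ^ 0 * p.2 ^ 2 - 2 * (p.1 ^ 4 * p.2 ^ 1) + p.1 ^ 8 * p.2 ^ 0 := by
    funext p; ring
  have hint : Integrable (fun p : ℝ × ℝ => (p.2 - p.1 ^ 4) ^ 2) μ := by
    rw [e]; exact (h02.1.sub (h41.1.const_mul 2)).add h80.1
  have hzero : ∫ p : ℝ × ℝ, (p.2 - p.1 ^ 4) ^ 2 ∂μ = 0 := by
    rw [e, integral_add (by exact h02.1.sub (h41.1.const_mul 2)) h80.1,
      integral_sub h02.1 (h41.1.const_mul 2), integral_const_mul, h02.2, h41.2, h80.2]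
    have h1 := hcol 0 1 (by omega)
    have h2 := hcol 4 0 (by omega)
    norm_num at h1 h2
    linarith
  rw [integral_eq_zero_iff_of_nonneg (fun p => sq_nonneg _) hint] at hzero
  filter_upwards [hzero] with p hp
  exact sub_eq_zero.1 (pow_eq_zero_iff two_ne_zero |>.1 hp)

/-- On the curve `y = x⁴`, `γ_p` is the `p`-th moment of the first coordinate. -/
lemma integrable_pow_and_integral_eq_gamma4 (hμ : IsRepMeasure n β μ)
    (hae : ∀ᵐ p ∂μ, p.2 = p.1 ^ 4) {m : ℕ} (hm : m % 4 + m / 4 ≤ 2 * n) :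
    Integrable (fun p : ℝ × ℝ => p.1 ^ m) μ ∧ ∫ p : ℝ × ℝ, p.1 ^ m ∂μ = gamma4 β m := by
  have h := hμ (m % 4) (m / 4) hm
  have e : (fun p : ℝ × ℝ => p.1 ^ (m % 4) * p.2 ^ (m / 4)) =ᵐ[μ] fun p => p.1 ^ m := by
    filter_upwards [hae] with p hp
    rw [hp, ← pow_mul, ← pow_add, Nat.mod_add_div]
  exact ⟨h.1.congr e, (integral_congr_ae e).symm.trans h.2⟩

lemma isGramMatrix_gamma4 (hμ : IsRepMeasure n β μ) (hae : ∀ᵐ p ∂μ, p.2 = p.1 ^ 4)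
    {ι : Type*} (e : ι → ℕ) (he : ∀ i j, (e i + e j) % 4 + (e i + e j) / 4 ≤ 2 * n) :
    IsGramMatrix μ (fun i (p : ℝ × ℝ) => p.1 ^ e i) (of fun i j => gamma4 β (e i + e j)) := by
  intro i j
  simpa only [← pow_add, of_apply] using hμ.integrable_pow_and_integral_eq_gamma4 hae (he i j)

/-- A representing measure on the curve `y = x⁴` of a pure sequence satisfies no polynomial
relation in the first coordinate of degree less than `4n - 2`. -/
lemma eq_zero_of_ae_eval_eq_zero (hμ : IsRepMeasure n β μ) (hn : 2 ≤ n)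
    (hae : ∀ᵐ p ∂μ, p.2 = p.1 ^ 4) (hpos : (momentMatrixHat n 4 β).PosDef)
    {P : Polynomial ℝ} (hdeg : P.natDegree < 4 * n - 2)
    (hP : ∀ᵐ p ∂μ, P.eval p.1 = 0) : P = 0 := by
  by_contra hne
  have hcard : P.roots.toFinset.card < Fintype.card (MomIdxHat n 4) :=
    calc _ ≤ P.natDegree := P.roots.toFinset_card_le.trans P.card_roots'
      _ < _ := hdeg.trans_le (le_card_momIdxHat_four n hn)
  obtain ⟨x, hx, hsum⟩ := exists_ne_zero_sum_mul_eq_zero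
    (fun (k : MomIdxHat n 4) (t : ℝ) => t ^ (k.1.1 : ℕ) * (t ^ 4) ^ (k.1.2 : ℕ)) _ hcard
  refine hx ((hμ.isGramMatrix_momentMatrixHat 4).eq_zero_of_posDef hpos ?_)
  filter_upwards [hae, hP] with p hp hp0
  rw [hp]
  exact hsum p.1 (by simp [hne, hp0])

end IsRepMeasure

/-- For the `(y − x⁴)`-pure truncated moment problem: if `β` admits a
representing measure, then `C₂` is positive definite and `C₃` is positive
semidefinite. -/
theorem pure_y_eq_x4_necessary (n : ℕ) (hn : 4 ≤ n)
    (β : ℕ → ℕ → ℝ) (hpure : IsPure n 4 β)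
    (hrep : ∃ μ : Measure (ℝ × ℝ), IsRepMeasure n β μ) :
    (C2mat n β).PosDef ∧ (C3mat n β).PosSemidef := by
  obtain ⟨-, hcol, -, hpos⟩ := hpure
  obtain ⟨μ, hμ⟩ := hrep
  have hae := hμ.ae_snd_eq_fst_pow_four hn hcol
  constructor
  · refine (hμ.isGramMatrix_gamma4 hae (fun i : Fin (4 * n - 2) => (i : ℕ))
      fun i j => by omega).posDef fun x hx => ?_
    have heval (t : ℝ) : (Polynomial.ofFn _ x).eval t = ∑ i, x i * t ^ (i : ℕ) := by
      simp [Polynomial.ofFn_eq_sum_monomial, Polynomial.eval_finsetSum]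
    have h0 := hμ.eq_zero_of_ae_eval_eq_zero (by omega) hae hpos
      (Polynomial.ofFn_natDegree_lt (by omega) x) (by simpa only [heval] using hx)
    funext i
    simpa [h0] using (Polynomial.ofFn_coeff_eq_val_of_lt x i.2).symm
  · exact (hμ.isGramMatrix_gamma4 hae (fun i : C3Idx n => (i.1 : ℕ))
      fun i j => by have := i.2; have := j.2; omega).posSemidef
end
end

section
/- Let n ≥ 4 be an integer and let β be a bivariate sequence of degree 2n such that M_n(β) is positive semidefinite and (y−x⁴)-pure (take d = 4). For integers p ≥ 0 with (p mod 4) + ⌊p/4⌋ ≤ 2n set γ_p := β_{p mod 4, ⌊p/4⌋} (defined for all 0 ≤ p ≤ 8n except p ∈ {8n−5, 8n−2, 8n−1}). Define C₁ := (γ_{p+q})_{0 ≤ p,q ≤ 4n−4}, C₂ := (γ_{p+q})_{0 ≤ p,q ≤ 4n−3}, C₃ := (γ_{p+q})_{p,q ∈ {0,…,4n−4} ∪ {4n−2}}, u := (γ_{p+4n−3})_{0 ≤ p ≤ 4n−4} and v := (γ_{p+4n−2})_{0 ≤ p ≤ 4n−4}, so that as block matrices C₂ = [[C₁, u],[uᵀ,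 γ_{8n−6}]] and C₃ = [[C₁, v],[vᵀ, γ_{8n−4}]]. Assume C₂ is positive definite and C₃ is positive semidefinite (then C₁ is positive definite, C₂/C₁ > 0 and C₃/C₁ ≥ 0), and set A_± := vᵀ C₁⁻¹ u ± √((C₂/C₁)(C₃/C₁)). For A ∈ ℝ, extend γ by setting γ_{8n−5} := A and define C₄[A] := (γ_{p+q})_{0 ≤ p,q ≤ 4n−2}, C₅[A] := (γ_{p+q})_{p,q ∈ {0,…,4n−3} ∪ {4n}}, w := (γ_{p+4n−1})_{0 ≤ p ≤ 4n−2}, s := (γ_{p+4n−2})_{0 ≤ p ≤ 4n−3}, t := (γ_{p+4n})_{0 ≤ p ≤ 4n−3}, so that C₄[A] = [[C₂, s],[sᵀ, γ_{8n−4}]] and C₅[A] = [[C₂, t],[tᵀ, γ_{8n}]]. Suppose there exists A ∈ ℝ with A₋ < A < A₊ such that C₅[A] is positive semidefinite and wᵀ C₄[A]⁻¹ w ≤ tᵀ C₂⁻¹ s + √((C₄[A]/C₂)(C₅[A]/C₂)). Then C₄[A] is positive definite (so C₄[A]⁻¹ exists and C₄[A]/C₂ > 0) and β admits a representing measure. 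-/
open MeasureTheory Matrix

noncomputable section

/-- The sequence `γ` extended by the auxiliary moment `γ_{8n−5} := A`. -/
def gamma4A (n : ℕ) (β : ℕ → ℕ → ℝ) (A : ℝ) (p : ℕ) : ℝ :=
  if p = 8 * n - 5 then A else gamma4 β p

/-- The Hankel matrix `C₁ = (γ_{p+q})_{0 ≤ p,q ≤ 4n−4}`. -/
def C1q (n : ℕ) (β : ℕ → ℕ → ℝ) : Matrix (Fin (4 * n - 3)) (Fin (4 * n - 3)) ℝ :=
  Matrix.of fun p q => gamma4 β ((p : ℕ) + (q : ℕ))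

/-- The vector `u = (γ_{p+4n−3})_{0 ≤ p ≤ 4n−4}`. -/
def uvec (n : ℕ) (β : ℕ → ℕ → ℝ) : Fin (4 * n - 3) → ℝ :=
  fun p => gamma4 β ((p : ℕ) + (4 * n - 3))

/-- The vector `v = (γ_{p+4n−2})_{0 ≤ p ≤ 4n−4}`. -/
def vvec (n : ℕ) (β : ℕ → ℕ → ℝ) : Fin (4 * n - 3) → ℝ :=
  fun p => gamma4 β ((p : ℕ) + (4 * n - 2))

/-- `A₋ = vᵀC₁⁻¹u − √((C₂/C₁)(C₃/C₁))`, where `C₂/C₁ = γ_{8n−6} − uᵀC₁⁻¹u` and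
`C₃/C₁ = γ_{8n−4} − vᵀC₁⁻¹v` are the indicated Schur complements. -/
def Aminus (n : ℕ) (β : ℕ → ℕ → ℝ) : ℝ :=
  vvec n β ⬝ᵥ (C1q n β)⁻¹ *ᵥ uvec n β -
    Real.sqrt ((gamma4 β (8 * n - 6) - uvec n β ⬝ᵥ (C1q n β)⁻¹ *ᵥ uvec n β) *
      (gamma4 β (8 * n - 4) - vvec n β ⬝ᵥ (C1q n β)⁻¹ *ᵥ vvec n β))

/-- `A₊ = vᵀC₁⁻¹u + √((C₂/C₁)(C₃/C₁))`. -/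
def Aplus (n : ℕ) (β : ℕ → ℕ → ℝ) : ℝ :=
  vvec n β ⬝ᵥ (C1q n β)⁻¹ *ᵥ uvec n β +
    Real.sqrt ((gamma4 β (8 * n - 6) - uvec n β ⬝ᵥ (C1q n β)⁻¹ *ᵥ uvec n β) *
      (gamma4 β (8 * n - 4) - vvec n β ⬝ᵥ (C1q n β)⁻¹ *ᵥ vvec n β))

/-- The Hankel matrix `C₄[A] = (γ_{p+q})_{0 ≤ p,q ≤ 4n−2}` (with `γ_{8n−5} = A`). -/
def C4mat (n : ℕ) (β : ℕ → ℕ → ℝ) (A : ℝ) :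
    Matrix (Fin (4 * n - 1)) (Fin (4 * n - 1)) ℝ :=
  Matrix.of fun p q => gamma4A n β A ((p : ℕ) + (q : ℕ))

/-- Index set `{0,…,4n−3} ∪ {4n}` for the matrix `C₅[A]`. -/
abbrev C5Idx (n : ℕ) : Type :=
  {m : Fin (4 * n + 1) // (m : ℕ) ≤ 4 * n - 3 ∨ (m : ℕ) = 4 * n}

/-- The matrix `C₅[A] = (γ_{p+q})_{p,q ∈ {0,…,4n−3} ∪ {4n}}` (with `γ_{8n−5} = A`). -/
def C5mat (n : ℕ) (β : ℕ → ℕ → ℝ) (A : ℝ) : Matrix (C5Idx n) (C5Idx n) ℝ :=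
  Matrix.of fun p q => gamma4A n β A ((p.1 : ℕ) + (q.1 : ℕ))

/-- The vector `w = (γ_{p+4n−1})_{0 ≤ p ≤ 4n−2}` (with `γ_{8n−5} = A`). -/
def wvec (n : ℕ) (β : ℕ → ℕ → ℝ) (A : ℝ) : Fin (4 * n - 1) → ℝ :=
  fun p => gamma4A n β A ((p : ℕ) + (4 * n - 1))

/-- The vector `s = (γ_{p+4n−2})_{0 ≤ p ≤ 4n−3}` (with `γ_{8n−5} = A`). -/
def svec (n : ℕ) (β : ℕ → ℕ → ℝ) (A : ℝ) : Fin (4 * n - 2) → ℝ :=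
  fun p => gamma4A n β A ((p : ℕ) + (4 * n - 2))

/-- The vector `t = (γ_{p+4n})_{0 ≤ p ≤ 4n−3}` (with `γ_{8n−5} = A`). -/
def tvec (n : ℕ) (β : ℕ → ℕ → ℝ) (A : ℝ) : Fin (4 * n - 2) → ℝ :=
  fun p => gamma4A n β A ((p : ℕ) + 4 * n)

/-- The Schur complement `C₄[A]/C₂ = γ_{8n−4} − sᵀC₂⁻¹s`. -/
def schur4 (n : ℕ) (β : ℕ → ℕ → ℝ) (A : ℝ) : ℝ :=
  gamma4 β (8 * n - 4) - svec n β A ⬝ᵥ (C2mat n β)⁻¹ *ᵥ svec n β A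

/-- The Schur complement `C₅[A]/C₂ = γ_{8n} − tᵀC₂⁻¹t`. -/
def schur5 (n : ℕ) (β : ℕ → ℕ → ℝ) (A : ℝ) : ℝ :=
  gamma4 β (8 * n) - tvec n β A ⬝ᵥ (C2mat n β)⁻¹ *ᵥ tvec n β A

open Polynomial

section PositiveFunctional

variable {Λ : ℝ[X] →ₗ[ℝ] ℝ}

/-- Cauchy–Schwarz degenerate case: a square-null polynomial is orthogonal to everything. -/
theorem map_mul_eq_zero_of_map_sq_eq_zero (hpos : ∀ f, 0 ≤ Λ (f * f)) {f : ℝ[X]}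
    (hf : Λ (f * f) = 0) (g : ℝ[X]) : Λ (g * f) = 0 := by
  have key : ∀ t : ℝ, 0 ≤ Λ (g * g) + 2 * t * Λ (g * f) := by
    intro t
    have h := hpos (g + t • f)
    have e : (g + t • f) * (g + t • f) = g * g + (2 * t) • (g * f) + (t * t) • (f * f) := by
      simp only [smul_eq_C_mul, C_mul, C_ofNat]; ring
    rw [e] at h
    simpa [hf] using h
  by_contra hne
  have h1 := key (-(Λ (g * g) + 1) / (2 * Λ (g * f)))
  have h2 : 2 * (-(Λ (g * g) + 1) / (2 * Λ (g * f))) * Λ (g * f) = -(Λ (g * g) + 1) := by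
    field_simp
  linarith

/-- A positive functional on `ℝ[X]` vanishing on a nonzero ideal is a finite nonnegative
combination of point evaluations. -/
theorem exists_eq_sum_eval_of_map_mul_eq_zero (hpos : ∀ f, 0 ≤ Λ (f * f)) {P : ℝ[X]} (hP : P ≠ 0)
    (hker : ∀ f, Λ (f * P) = 0) :
    ∃ (S : Finset ℝ) (w : ℝ → ℝ), (∀ a ∈ S, 0 ≤ w a) ∧
      ∀ f, Λ f = ∑ a ∈ S, w a * f.eval a := by
  classical
  obtain ⟨Q, ⟨hQ0, hQker⟩, hQmin⟩ : ∃ Q : ℝ[X], (Q ≠ 0 ∧ ∀ f, Λ (f * Q) = 0) ∧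
      ∀ R : ℝ[X], R ≠ 0 → (∀ f, Λ (f * R) = 0) → Q.natDegree ≤ R.natDegree := by
    have hne : {R : ℝ[X] | R ≠ 0 ∧ ∀ f, Λ (f * R) = 0}.Nonempty := ⟨P, hP, hker⟩
    refine ⟨Function.argminOn natDegree _ hne, Function.argminOn_mem natDegree _ hne, ?_⟩
    intro R h1 h2
    exact Function.argminOn_le natDegree {R : ℝ[X] | R ≠ 0 ∧ ∀ f, Λ (f * R) = 0} ⟨h1, h2⟩
  have hsq : ∀ R : ℝ[X], R ≠ 0 → R.natDegree < Q.natDegree → Λ (R * R) ≠ 0 := by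
    intro R hR hlt h0
    exact absurd (hQmin R hR (map_mul_eq_zero_of_map_sq_eq_zero hpos h0)) (not_le.mpr hlt)
  have hreal : ∀ z : ℂ, aeval z Q = 0 → z.im = 0 := by
    intro z hz
    by_contra him
    obtain ⟨h, rfl⟩ := quadratic_dvd_of_aeval_eq_zero_im_ne_zero Q hz him
    set q : ℝ[X] := X ^ 2 - C (2 * z.re) * X + C (‖z‖ ^ 2) with hq
    have hqeq : q = (X - C z.re) ^ 2 + C (z.im ^ 2) := by
      have : ‖z‖ ^ 2 = z.re ^ 2 + z.im ^ 2 := by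
        rw [← Complex.normSq_eq_norm_sq, Complex.normSq_apply]; ring
      rw [hq, this]
      simp only [C_mul, C_add, C_pow, C_ofNat]; ring
    have hqdeg : q.natDegree = 2 := by
      rw [hqeq]; compute_degree!
    have hh0 : h ≠ 0 := right_ne_zero_of_mul hQ0
    have hq0 : q ≠ 0 := left_ne_zero_of_mul hQ0
    have e : h * (q * h) = ((X - C z.re) * h) * ((X - C z.re) * h) + (z.im ^ 2) • (h * h) := by
      rw [hqeq, smul_eq_C_mul]; ring
    have h1 := hQker h
    rw [e, map_add, map_smul, smul_eq_mul] at h1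
    have h2 := hpos ((X - C z.re) * h)
    have h3 := hpos h
    have h4 : 0 < z.im ^ 2 := by positivity
    have h5 : Λ (h * h) = 0 := by nlinarith
    refine hsq h hh0 ?_ h5
    rw [natDegree_mul hq0 hh0]; omega
  have hnodup : Q.roots.Nodup := by
    rw [Multiset.nodup_iff_count_le_one]
    intro a
    rw [count_roots]
    by_contra! hlt
    obtain ⟨h, hh⟩ := (le_rootMultiplicity_iff hQ0).mp hlt
    have hh0 : h ≠ 0 := by rintro rfl; simp [hQ0] at hh
    have hX : (X - C a : ℝ[X]) ≠ 0 := X_sub_C_ne_zero a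
    refine hsq ((X - C a) * h) (mul_ne_zero hX hh0) ?_ ?_
    · rw [hh, natDegree_mul hX hh0, natDegree_mul (pow_ne_zero _ hX) hh0]
      simp
    · rw [← hQker h, hh]; congr 1; ring
  have hsplit : Q.Splits := by
    obtain ⟨q, hq, hcard, hroots⟩ := exists_prod_multiset_X_sub_C_mul Q
    rw [splits_iff_card_roots]
    suffices q.natDegree = 0 by omega
    by_contra hdeg
    have hdeg' : (q.map (algebraMap ℝ ℂ)).degree ≠ 0 := by
      rw [degree_map]
      intro h
      exact hdeg (natDegree_eq_of_degree_eq_some h)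
    obtain ⟨z, hz⟩ := IsAlgClosed.exists_root _ hdeg'
    have hzq : aeval z q = 0 := by rwa [IsRoot.def, eval_map_algebraMap] at hz
    have him := hreal z (by rw [← hq, map_mul, hzq, mul_zero])
    have hzr : z = algebraMap ℝ ℂ z.re := by
      apply Complex.ext <;> simp [him]
    rw [hzr, aeval_algebraMap_apply] at hzq
    have hroot : q.IsRoot z.re := by simpa using hzq
    have hq0 : q ≠ 0 := by rintro rfl; simp at hdeg
    have := (mem_roots hq0).mpr hroot
    simp [hroots] at this
  have hvanish : ∀ f : ℝ[X], (∀ a ∈ Q.roots.toFinset, f.eval a = 0) → Λ f = 0 := by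
    intro f hf
    rcases eq_or_ne f 0 with rfl | hf0
    · simp
    obtain ⟨g, rfl⟩ := hsplit.dvd_of_roots_le_roots (g := f) hQ0 (by
      rw [Multiset.le_iff_subset hnodup]
      intro a ha
      exact (mem_roots hf0).mpr (hf a (by simpa using ha)))
    rw [mul_comm]; exact hQker g
  set S := Q.roots.toFinset with hS
  have hbasis : ∀ a ∈ S, ∀ b ∈ S, (Lagrange.basis S id b).eval a = if a = b then 1 else 0 := by
    intro a ha b hb
    split_ifs with h
    · subst h; exact Lagrange.eval_basis_self (v := id) Function.injective_id.injOn ha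
    · exact Lagrange.eval_basis_of_ne (v := id) (Ne.symm h) ha
  refine ⟨S, fun a => Λ (Lagrange.basis S id a), fun a ha => ?_, fun f => ?_⟩
  · have h := hvanish (Lagrange.basis S id a * Lagrange.basis S id a - Lagrange.basis S id a) (by
      intro b hb
      rw [eval_sub, eval_mul, hbasis b hb a ha]
      split_ifs <;> simp)
    rw [map_sub, sub_eq_zero] at h
    change 0 ≤ Λ (Lagrange.basis S id a)
    rw [← h]
    exact hpos _
  · have h := hvanish (f - ∑ a ∈ S, f.eval a • Lagrange.basis S id a) (by
      intro b hb
      rw [eval_sub, eval_finsetSum, Finset.sum_congr rfl (fun a ha => by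
        rw [eval_smul, hbasis b hb a ha]), Finset.sum_eq_single b]
      · simp
      · intro a _ hab; simp [hab.symm]
      · exact fun h => absurd hb h)
    rw [map_sub, sub_eq_zero] at h
    rw [h, map_sum]
    refine Finset.sum_congr rfl fun a _ => ?_
    rw [map_smul, smul_eq_mul, mul_comm]

/-- A functional that is positive on polynomials of degree at most `m` and has a monic degree `m`
polynomial in its kernel is, in degree at most `2m`, a nonnegative combination of point
evaluations. -/
theorem exists_eq_sum_eval_of_natDegree_le {L : ℝ[X] →ₗ[ℝ] ℝ} {m : ℕ} {P : ℝ[X]} (hP : P.Monic)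
    (hdeg : P.natDegree = m) (hpos : ∀ f : ℝ[X], f.natDegree ≤ m → 0 ≤ L (f * f))
    (hker : ∀ f : ℝ[X], f.natDegree ≤ m → L (f * P) = 0) :
    ∃ (S : Finset ℝ) (w : ℝ → ℝ), (∀ a ∈ S, 0 ≤ w a) ∧
      ∀ f : ℝ[X], f.natDegree ≤ 2 * m → L f = ∑ a ∈ S, w a * f.eval a := by
  have hL : ∀ f : ℝ[X], f.natDegree ≤ 2 * m → L (f %ₘ P) = L f := by
    intro f hf
    conv_rhs => rw [← modByMonic_add_div f P]
    rw [map_add, mul_comm P, hker _ (by rw [natDegree_divByMonic f hP]; omega), add_zero]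
  have hmod : ∀ f : ℝ[X], (f %ₘ P).natDegree ≤ m := by
    intro f
    exact hdeg ▸ natDegree_modByMonic_le f hP
  obtain ⟨S, w, hw, h⟩ := exists_eq_sum_eval_of_map_mul_eq_zero (Λ := L ∘ₗ modByMonicHom P)
    (fun f => by
      have e : (f * f) %ₘ P = ((f %ₘ P) * (f %ₘ P)) %ₘ P := mul_modByMonic f f P
      have h2 : ((f %ₘ P) * (f %ₘ P)).natDegree ≤ 2 * m :=
        natDegree_mul_le.trans (by have := hmod f; omega)
      change 0 ≤ L ((f * f) %ₘ P)
      rw [e, hL _ h2]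
      exact hpos _ (hmod f)) hP.ne_zero
    (fun f => by
      change L ((f * P) %ₘ P) = 0
      rw [mul_self_modByMonic hP, map_zero])
  exact ⟨S, w, hw, fun f hf => by rw [← h, ← hL f hf]; rfl⟩

end PositiveFunctional

section MomentFunctional

/-- The Riesz functional `X ^ i ↦ g i` of a real sequence. -/
def momentFunctional (g : ℕ → ℝ) : ℝ[X] →ₗ[ℝ] ℝ :=
  lsum fun i => g i • LinearMap.id

theorem momentFunctional_apply (g : ℕ → ℝ) (f : ℝ[X]) :
    momentFunctional g f = f.sum fun i c => g i * c := rfl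

theorem momentFunctional_monomial (g : ℕ → ℝ) (i : ℕ) (c : ℝ) :
    momentFunctional g (monomial i c) = g i * c := by
  rw [momentFunctional_apply, sum_monomial_index _ _ (by simp)]

theorem momentFunctional_X_pow (g : ℕ → ℝ) (i : ℕ) : momentFunctional g (X ^ i) = g i := by
  rw [X_pow_eq_monomial, momentFunctional_monomial, mul_one]

theorem momentFunctional_update (g : ℕ → ℝ) (N : ℕ) (d : ℝ) (f : ℝ[X]) :
    momentFunctional (Function.update g N d) f =
      momentFunctional g f + f.coeff N * (d - g N) := by
  induction f using Polynomial.induction_on' with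
  | add p q hp hq => rw [map_add, map_add, hp, hq, coeff_add]; ring
  | monomial i c =>
    rw [momentFunctional_monomial, momentFunctional_monomial, coeff_monomial]
    by_cases h : i = N
    · subst h; simp; ring
    · simp [h]

/-- The polynomial with coefficients `c` on the exponents `e`. -/
def polyOf {ι : Type*} [Fintype ι] (e : ι → ℕ) (c : ι → ℝ) : ℝ[X] :=
  ∑ i, monomial (e i) (c i)

section polyOf

variable {ι : Type*} [Fintype ι] {e : ι → ℕ}

theorem coeff_polyOf_apply (he : Function.Injective e) (c : ι → ℝ) (i : ι) :
    (polyOf e c).coeff (e i) = c i := by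
  classical
  rw [polyOf, finsetSum_coeff]
  simp [coeff_monomial, he.eq_iff]

theorem coeff_polyOf_eq_zero (c : ι → ℝ) {m : ℕ} (hm : ∀ i, e i ≠ m) :
    (polyOf e c).coeff m = 0 := by
  rw [polyOf, finsetSum_coeff]
  exact Finset.sum_eq_zero fun i _ => by simp [coeff_monomial, hm i]

theorem polyOf_coeff (he : Function.Injective e) {f : ℝ[X]}
    (hf : ∀ m, (∀ i, e i ≠ m) → f.coeff m = 0) : polyOf e (fun i => f.coeff (e i)) = f := by
  ext m
  by_cases h : ∃ i, e i = m
  · obtain ⟨i, rfl⟩ := h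
    exact coeff_polyOf_apply he _ i
  · push Not at h
    rw [coeff_polyOf_eq_zero _ h, hf m h]

theorem momentFunctional_polyOf_mul (g : ℕ → ℝ) (c : ι → ℝ) (p : ℝ[X]) :
    momentFunctional g (polyOf e c * p) = ∑ i, c i * momentFunctional g (X ^ e i * p) := by
  rw [polyOf, Finset.sum_mul, map_sum]
  refine Finset.sum_congr rfl fun i _ => ?_
  rw [← smul_X_eq_monomial, smul_mul_assoc, map_smul, smul_eq_mul]

theorem momentFunctional_X_pow_mul_polyOf (g : ℕ → ℝ) (q : ℕ) (c : ι → ℝ) :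
    momentFunctional g (X ^ q * polyOf e c) = ∑ i, g (e i + q) * c i := by
  rw [mul_comm, momentFunctional_polyOf_mul]
  refine Finset.sum_congr rfl fun i _ => ?_
  rw [← pow_add, momentFunctional_X_pow, mul_comm]

theorem momentFunctional_polyOf_mul_self {g : ℕ → ℝ} {M : Matrix ι ι ℝ}
    (hM : ∀ i j, M i j = g (e i + e j)) (c : ι → ℝ) :
    momentFunctional g (polyOf e c * polyOf e c) = c ⬝ᵥ M *ᵥ c := by
  rw [momentFunctional_polyOf_mul]
  simp only [dotProduct, mulVec, momentFunctional_X_pow_mul_polyOf, hM]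
  simp only [add_comm]

theorem momentFunctional_mul_self_nonneg {g : ℕ → ℝ} {M : Matrix ι ι ℝ} (hpsd : M.PosSemidef)
    (he : Function.Injective e) (hM : ∀ i j, M i j = g (e i + e j)) {f : ℝ[X]}
    (hf : ∀ m, (∀ i, e i ≠ m) → f.coeff m = 0) : 0 ≤ momentFunctional g (f * f) := by
  rw [← polyOf_coeff he hf, momentFunctional_polyOf_mul_self hM]
  simpa using hpsd.dotProduct_mulVec_nonneg fun i => f.coeff (e i)

end polyOf

variable {k : ℕ} {g : ℕ → ℝ} {M : Matrix (Fin k) (Fin k) ℝ}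

theorem polyOf_val_coeff {f : ℝ[X]} (hf : f.degree < k) :
    polyOf Fin.val (fun i : Fin k => f.coeff i) = f := by
  refine polyOf_coeff Fin.val_injective fun m hm => ?_
  refine (degree_lt_iff_coeff_zero f k).mp hf m ?_
  by_contra! h
  exact hm ⟨m, h⟩ rfl

theorem degree_polyOf_val_lt (c : Fin k → ℝ) : (polyOf Fin.val c).degree < k :=
  (degree_lt_iff_coeff_zero _ _).mpr fun _ hm => coeff_polyOf_eq_zero _ fun i => by omega

theorem momentFunctional_mul_self_pos (hpd : M.PosDef)
    (hM : ∀ i j, M i j = g ((i : ℕ) + (j : ℕ))) {f : ℝ[X]}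
    (hf : f.degree < k) (hf0 : f ≠ 0) : 0 < momentFunctional g (f * f) := by
  rw [← polyOf_val_coeff hf, momentFunctional_polyOf_mul_self hM]
  have hne : (fun i : Fin k => f.coeff i) ≠ 0 := by
    intro h
    apply hf0
    rw [← polyOf_val_coeff hf, h]
    simp [polyOf]
  simpa using hpd.dotProduct_mulVec_pos hne

theorem posDef_of_momentFunctional_pos (hM : ∀ i j, M i j = g ((i : ℕ) + (j : ℕ)))
    (h : ∀ f : ℝ[X], f.degree < k → f ≠ 0 → 0 < momentFunctional g (f * f)) : M.PosDef := by
  refine Matrix.PosDef.of_dotProduct_mulVec_pos ?_ fun c hc => ?_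
  · ext i j
    simp [hM, add_comm]
  · have hne : polyOf Fin.val c ≠ 0 := by
      intro h0
      apply hc
      ext i
      rw [← coeff_polyOf_apply Fin.val_injective c i, h0]
      simp
    have := h _ (degree_polyOf_val_lt c) hne
    rw [momentFunctional_polyOf_mul_self hM] at this
    simpa using this

/-- `X ^ r` minus its orthogonal projection on the polynomials of degree less than `k`, where `M`
is the Hankel matrix of size `k` and `z` the vector of moments of `X ^ r` against the monomials. -/
def orthPoly (M : Matrix (Fin k) (Fin k) ℝ) (z : Fin k → ℝ) (r : ℕ) : ℝ[X] :=
  X ^ r - polyOf Fin.val (M⁻¹ *ᵥ z)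

theorem coeff_orthPoly (z : Fin k → ℝ) (r : ℕ) {m : ℕ} (hm : k ≤ m) :
    (orthPoly M z r).coeff m = if m = r then 1 else 0 := by
  rw [orthPoly, coeff_sub, coeff_X_pow, coeff_polyOf_eq_zero _ fun i => by omega, sub_zero]

theorem momentFunctional_X_pow_mul_orthPoly {q r : ℕ} {y z : Fin k → ℝ}
    (hy : ∀ i, y i = g ((i : ℕ) + q)) :
    momentFunctional g (X ^ q * orthPoly M z r) = g (q + r) - y ⬝ᵥ M⁻¹ *ᵥ z := by
  rw [orthPoly, mul_sub, map_sub, ← pow_add, momentFunctional_X_pow,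
    momentFunctional_X_pow_mul_polyOf]
  simp only [dotProduct, hy]

theorem momentFunctional_mul_orthPoly_eq_zero (hpd : M.PosDef)
    (hM : ∀ i j, M i j = g ((i : ℕ) + (j : ℕ))) {r : ℕ} {z : Fin k → ℝ}
    (hz : ∀ i, z i = g ((i : ℕ) + r)) {f : ℝ[X]} (hf : f.degree < k) :
    momentFunctional g (f * orthPoly M z r) = 0 := by
  rw [← polyOf_val_coeff hf, momentFunctional_polyOf_mul]
  refine Finset.sum_eq_zero fun i _ => ?_
  have hinv : M *ᵥ (M⁻¹ *ᵥ z) = z := by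
    rw [mulVec_mulVec, mul_nonsing_inv _ (isUnit_iff_ne_zero.mpr hpd.det_pos.ne'), one_mulVec]
  have h2 : (fun j => M i j) ⬝ᵥ M⁻¹ *ᵥ z = z i := congrFun hinv i
  rw [momentFunctional_X_pow_mul_orthPoly (y := fun j => M i j)
    (fun j => by rw [hM, add_comm]), h2, hz, sub_self, mul_zero]

theorem momentFunctional_orthPoly_mul_orthPoly (hpd : M.PosDef)
    (hM : ∀ i j, M i j = g ((i : ℕ) + (j : ℕ))) {q r : ℕ} {y z : Fin k → ℝ}
    (hy : ∀ i, y i = g ((i : ℕ) + q)) (hz : ∀ i, z i = g ((i : ℕ) + r)) :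
    momentFunctional g (orthPoly M y q * orthPoly M z r) = g (q + r) - y ⬝ᵥ M⁻¹ *ᵥ z := by
  conv_lhs => rw [orthPoly, sub_mul]
  rw [map_sub, momentFunctional_X_pow_mul_orthPoly hy,
    momentFunctional_mul_orthPoly_eq_zero hpd hM hz (degree_polyOf_val_lt _), sub_zero]

end MomentFunctional

/-- A binary quadratic form with positive leading coefficient and negative discriminant is
positive definite. -/
theorem binary_form_pos {p q r a b : ℝ} (hp : 0 < p) (hdisc : q ^ 2 < p * r)
    (hab : a ≠ 0 ∨ b ≠ 0) : 0 < a ^ 2 * p + 2 * a * b * q + b ^ 2 * r := by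
  refine pos_of_mul_pos_right (a := p) ?_ hp.le
  rw [show p * (a ^ 2 * p + 2 * a * b * q + b ^ 2 * r) =
    (a * p + b * q) ^ 2 + b ^ 2 * (p * r - q ^ 2) by ring]
  by_cases hb : b = 0
  · have ha : a ≠ 0 := hab.resolve_right (not_not.mpr hb)
    have : 0 < (a * p) ^ 2 := by positivity
    simpa [hb] using this
  · have : 0 < b ^ 2 * (p * r - q ^ 2) := mul_pos (by positivity) (by linarith)
    positivity

theorem C4mat_posDef {n : ℕ} (hn : 4 ≤ n) {β : ℕ → ℕ → ℝ} (hC2 : (C2mat n β).PosDef)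
    (hC3 : (C3mat n β).PosSemidef) {A : ℝ} (hA1 : Aminus n β < A) (hA2 : A < Aplus n β) :
    (C4mat n β A).PosDef := by
  set g := gamma4A n β A with hg
  have hgg : ∀ p, p ≠ 8 * n - 5 → gamma4 β p = g p := fun p hp => by simp [hg, gamma4A, hp]
  have hC1 : (C1q n β).PosDef :=
    hC2.submatrix (e := Fin.castLE (by omega : 4 * n - 3 ≤ 4 * n - 2)) (Fin.castLE_injective _)
  have hM : ∀ i j, C1q n β i j = g ((i : ℕ) + (j : ℕ)) := fun i j => hgg _ (by omega)
  have hM2 : ∀ i j, C2mat n β i j = g ((i : ℕ) + (j : ℕ)) := fun i j => hgg _ (by omega)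
  have hu : ∀ i, uvec n β i = g ((i : ℕ) + (4 * n - 3)) := fun i => hgg _ (by omega)
  have hv : ∀ i, vvec n β i = g ((i : ℕ) + (4 * n - 2)) := fun i => hgg _ (by omega)
  set L := momentFunctional g with hL
  set e₁ := orthPoly (C1q n β) (uvec n β) (4 * n - 3) with he₁
  set e₂ := orthPoly (C1q n β) (vvec n β) (4 * n - 2) with he₂
  have c₁ : ∀ m, 4 * n - 3 ≤ m → e₁.coeff m = if m = 4 * n - 3 then 1 else 0 :=
    fun m hm => coeff_orthPoly _ _ hm
  have c₂ : ∀ m, 4 * n - 3 ≤ m → e₂.coeff m = if m = 4 * n - 2 then 1 else 0 :=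
    fun m hm => coeff_orthPoly _ _ hm
  have h11 : L (e₁ * e₁) = gamma4 β (8 * n - 6) - uvec n β ⬝ᵥ (C1q n β)⁻¹ *ᵥ uvec n β := by
    rw [hL, he₁, momentFunctional_orthPoly_mul_orthPoly hC1 hM hu hu, hgg _ (by omega)]
    congr 2; omega
  have h22 : L (e₂ * e₂) = gamma4 β (8 * n - 4) - vvec n β ⬝ᵥ (C1q n β)⁻¹ *ᵥ vvec n β := by
    rw [hL, he₂, momentFunctional_orthPoly_mul_orthPoly hC1 hM hv hv, hgg _ (by omega)]
    congr 2; omega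
  have h21 : L (e₂ * e₁) = A - vvec n β ⬝ᵥ (C1q n β)⁻¹ *ᵥ uvec n β := by
    rw [hL, he₁, he₂, momentFunctional_orthPoly_mul_orthPoly hC1 hM hv hu,
      show 4 * n - 2 + (4 * n - 3) = 8 * n - 5 by omega]
    simp [hg, gamma4A]
  have hpos1 : 0 < L (e₁ * e₁) := by
    refine momentFunctional_mul_self_pos hC2 hM2 ?_ ?_
    · refine (degree_lt_iff_coeff_zero _ _).mpr fun m hm => ?_
      rw [c₁ m (by omega), if_neg (by omega)]
    · intro h
      have := c₁ (4 * n - 3) le_rfl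
      simp [h] at this
  have hpos2 : 0 ≤ L (e₂ * e₂) := by
    refine momentFunctional_mul_self_nonneg (e := fun i : C3Idx n => (i.1 : ℕ)) hC3
      (fun i j h => Subtype.ext (Fin.ext h)) (fun i j => hgg _ ?_) fun m hm => ?_
    · have h1 := i.2
      have h2 := j.2
      omega
    · have hm' : m = 4 * n - 3 ∨ 4 * n - 1 ≤ m := by
        by_contra! hcon
        exact hm ⟨⟨m, hcon.2⟩, hcon.1⟩ rfl
      rw [c₂ m (by omega), if_neg (by omega)]
  have hdisc : L (e₂ * e₁) ^ 2 < L (e₁ * e₁) * L (e₂ * e₂) := by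
    rw [Aminus, ← h11, ← h22] at hA1
    rw [Aplus, ← h11, ← h22] at hA2
    rw [h21, ← Real.sq_sqrt (mul_nonneg hpos1.le hpos2)]
    exact sq_lt_sq' (by linarith) (by linarith)
  refine posDef_of_momentFunctional_pos (g := g) (fun i j => rfl) fun f hf hf0 => ?_
  rw [degree_lt_iff_coeff_zero] at hf
  set a := f.coeff (4 * n - 3)
  set b := f.coeff (4 * n - 2)
  set f₀ := f - C a * e₁ - C b * e₂ with hf₀
  have hdeg : f₀.degree < (4 * n - 3 : ℕ) := by
    refine (degree_lt_iff_coeff_zero _ _).mpr fun m hm => ?_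
    rw [hf₀, coeff_sub, coeff_sub, coeff_C_mul, coeff_C_mul, c₁ m hm, c₂ m hm]
    by_cases h1 : m = 4 * n - 3
    · subst h1; simp [a, show 4 * n - 3 ≠ 4 * n - 2 by omega]
    by_cases h2 : m = 4 * n - 2
    · subst h2; simp [b, show 4 * n - 2 ≠ 4 * n - 3 by omega]
    simp [h1, h2, hf m (by omega)]
  have o₁ : L (f₀ * e₁) = 0 := momentFunctional_mul_orthPoly_eq_zero hC1 hM hu hdeg
  have o₂ : L (f₀ * e₂) = 0 := momentFunctional_mul_orthPoly_eq_zero hC1 hM hv hdeg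
  have e : f * f = f₀ * f₀ + (2 * a) • (f₀ * e₁) + (2 * b) • (f₀ * e₂) + (a ^ 2) • (e₁ * e₁) +
      (2 * a * b) • (e₂ * e₁) + (b ^ 2) • (e₂ * e₂) := by
    have : f = f₀ + C a * e₁ + C b * e₂ := by rw [hf₀]; ring
    rw [this]
    simp only [smul_eq_C_mul, C_mul, C_pow, C_ofNat]; ring
  rw [← hL, e]
  simp only [map_add, map_smul, smul_eq_mul, o₁, o₂, mul_zero, add_zero]
  by_cases hab : a = 0 ∧ b = 0
  · have : f₀ = f := by rw [hf₀, hab.1, hab.2]; simp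
    rw [hab.1, hab.2, this]
    have := momentFunctional_mul_self_pos hC1 hM (this ▸ hdeg) hf0
    simpa using this
  · have h0 : 0 ≤ L (f₀ * f₀) := by
      by_cases h : f₀ = 0
      · simp [h]
      · exact (momentFunctional_mul_self_pos hC1 hM hdeg h).le
    have := binary_form_pos hpos1 hdisc (a := a) (b := b) (by tauto)
    linarith

set_option maxHeartbeats 1000000 in
/-- Hankel completion: the missing moments can be chosen so that the Riesz functional is positive
in degree `4n` and singular with a monic null polynomial of full degree. -/
theorem exists_completion {n : ℕ} (hn : 4 ≤ n) {β : ℕ → ℕ → ℝ} {A : ℝ}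
    (hC2 : (C2mat n β).PosDef) (hC4 : (C4mat n β A).PosDef) (hC5 : (C5mat n β A).PosSemidef)
    (hineq : wvec n β A ⬝ᵥ (C4mat n β A)⁻¹ *ᵥ wvec n β A ≤
      tvec n β A ⬝ᵥ (C2mat n β)⁻¹ *ᵥ svec n β A +
        Real.sqrt (schur4 n β A * schur5 n β A)) :
    ∃ (g : ℕ → ℝ) (P : ℝ[X]),
      (∀ p, p ≠ 8 * n - 5 → p ≠ 8 * n - 2 → p ≠ 8 * n - 1 → g p = gamma4 β p) ∧
      P.Monic ∧ P.natDegree = 4 * n ∧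
      (∀ f : ℝ[X], f.natDegree ≤ 4 * n → 0 ≤ momentFunctional g (f * f)) ∧
      ∀ f : ℝ[X], f.natDegree ≤ 4 * n → momentFunctional g (f * P) = 0 := by
  set B := tvec n β A ⬝ᵥ (C2mat n β)⁻¹ *ᵥ svec n β A +
        Real.sqrt (schur4 n β A * schur5 n β A) with hB
  set g₁ := Function.update (gamma4A n β A) (8 * n - 2) B with hg₁
  set ρ := Real.sqrt (schur4 n β A * schur5 n β A) / schur4 n β A with hρ
  set e₃ := orthPoly (C2mat n β) (svec n β A) (4 * n - 2) with he₃
  set e₄ := orthPoly (C2mat n β) (tvec n β A) (4 * n) with he₄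
  set e₅ := orthPoly (C4mat n β A) (wvec n β A) (4 * n - 1) with he₅
  set P := e₄ - C ρ * e₃ with hP
  have c₃ : ∀ m, 4 * n - 2 ≤ m → e₃.coeff m = if m = 4 * n - 2 then 1 else 0 :=
    fun m hm => coeff_orthPoly _ _ hm
  have c₄ : ∀ m, 4 * n - 2 ≤ m → e₄.coeff m = if m = 4 * n then 1 else 0 :=
    fun m hm => coeff_orthPoly _ _ hm
  have c₅ : ∀ m, 4 * n - 1 ≤ m → e₅.coeff m = if m = 4 * n - 1 then 1 else 0 :=
    fun m hm => coeff_orthPoly _ _ hm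
  have cP : ∀ m, 4 * n - 1 ≤ m → P.coeff m = if m = 4 * n then 1 else 0 := by
    intro m hm
    rw [hP, coeff_sub, coeff_C_mul, c₃ m (by omega), c₄ m (by omega),
      if_neg (show m ≠ 4 * n - 2 by omega), mul_zero, sub_zero]
  have hPle : P.natDegree ≤ 4 * n := by
    refine natDegree_le_iff_coeff_eq_zero.mpr fun m hm => ?_
    rw [cP m (by omega), if_neg (by omega)]
  have hP1 : P.coeff (4 * n) = 1 := by rw [cP _ (by omega), if_pos rfl]
  have hPmonic : P.Monic := monic_of_natDegree_le_of_coeff_eq_one _ hPle hP1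
  have hPdeg : P.natDegree = 4 * n :=
    le_antisymm hPle (le_natDegree_of_ne_zero (by rw [hP1]; exact one_ne_zero))
  have h5le : e₅.natDegree ≤ 4 * n - 1 := by
    refine natDegree_le_iff_coeff_eq_zero.mpr fun m hm => ?_
    rw [c₅ m (by omega), if_neg (by omega)]
  set g := Function.update g₁ (8 * n - 1) (g₁ (8 * n - 1) - momentFunctional g₁ (e₅ * P)) with hg
  set L := momentFunctional g with hL
  have hgA : ∀ p, p ≠ 8 * n - 2 → p ≠ 8 * n - 1 → gamma4A n β A p = g p := fun p h2 h1 => by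
    rw [hg, Function.update_of_ne h1, hg₁, Function.update_of_ne h2]
  have hgg : ∀ p, p ≠ 8 * n - 5 → p ≠ 8 * n - 2 → p ≠ 8 * n - 1 → gamma4 β p = g p :=
    fun p h5 h2 h1 => by rw [← hgA p h2 h1]; simp [gamma4A, h5]
  have hgB : g (8 * n - 2) = B := by
    rw [hg, Function.update_of_ne (by omega), hg₁, Function.update_self]
  have hM2 : ∀ i j, C2mat n β i j = g ((i : ℕ) + (j : ℕ)) :=
    fun i j => hgg _ (by omega) (by omega) (by omega)
  have hM4 : ∀ i j, C4mat n β A i j = g ((i : ℕ) + (j : ℕ)) :=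
    fun i j => hgA _ (by omega) (by omega)
  have hs : ∀ i, svec n β A i = g ((i : ℕ) + (4 * n - 2)) := fun i => hgA _ (by omega) (by omega)
  have ht : ∀ i, tvec n β A i = g ((i : ℕ) + 4 * n) := fun i => hgA _ (by omega) (by omega)
  have hw : ∀ i, wvec n β A i = g ((i : ℕ) + (4 * n - 1)) := fun i => hgA _ (by omega) (by omega)
  have h33 : L (e₃ * e₃) = schur4 n β A := by
    rw [hL, he₃, momentFunctional_orthPoly_mul_orthPoly hC2 hM2 hs hs, schur4,
      hgg _ (by omega) (by omega) (by omega)]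
    congr 2; omega
  have h44 : L (e₄ * e₄) = schur5 n β A := by
    rw [hL, he₄, momentFunctional_orthPoly_mul_orthPoly hC2 hM2 ht ht, schur5,
      hgg _ (by omega) (by omega) (by omega)]
    congr 2; omega
  have h43 : L (e₄ * e₃) = Real.sqrt (schur4 n β A * schur5 n β A) := by
    rw [hL, he₃, he₄, momentFunctional_orthPoly_mul_orthPoly hC2 hM2 ht hs,
      show 4 * n + (4 * n - 2) = 8 * n - 2 by omega, hgB, hB]
    ring
  have h55 : 0 ≤ L (e₅ * e₅) := by
    rw [hL, he₅, momentFunctional_orthPoly_mul_orthPoly hC4 hM4 hw hw,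
      show 4 * n - 1 + (4 * n - 1) = 8 * n - 2 by omega, hgB]
    linarith
  have h5P : L (e₅ * P) = 0 := by
    have hc : (e₅ * P).coeff (8 * n - 1) = 1 := by
      rw [show 8 * n - 1 = (4 * n - 1) + 4 * n by omega, coeff_mul_add_eq_of_natDegree_le h5le hPle,
        hP1, c₅ _ le_rfl, if_pos rfl, one_mul]
    rw [hL, hg, momentFunctional_update, hc]
    ring
  have hpos3 : 0 < schur4 n β A := by
    rw [← h33]
    refine momentFunctional_mul_self_pos hC4 hM4 ?_ ?_
    · refine (degree_lt_iff_coeff_zero _ _).mpr fun m hm => ?_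
      rw [c₃ m (by omega), if_neg (by omega)]
    · intro h
      have := c₃ (4 * n - 2) le_rfl
      simp [h] at this
  have hpos4 : 0 ≤ schur5 n β A := by
    rw [← h44]
    refine momentFunctional_mul_self_nonneg (e := fun i : C5Idx n => (i.1 : ℕ)) hC5
      (fun i j h => Subtype.ext (Fin.ext h)) (fun i j => hgA _ ?_ ?_) fun m hm => ?_
    · have h1 := i.2
      have h2 := j.2
      omega
    · have h1 := i.2
      have h2 := j.2
      omega
    · have hm' : m ≠ 4 * n ∧ 4 * n - 2 ≤ m := by
        by_contra! hcon
        by_cases h : m = 4 * n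
        · exact hm ⟨⟨m, by omega⟩, Or.inr h⟩ rfl
        · have := hcon h
          exact hm ⟨⟨m, by omega⟩, Or.inl (show m ≤ 4 * n - 3 by omega)⟩ rfl
      rw [c₄ m hm'.2, if_neg hm'.1]
  have hsq : Real.sqrt (schur4 n β A * schur5 n β A) *
      Real.sqrt (schur4 n β A * schur5 n β A) = schur4 n β A * schur5 n β A :=
    Real.mul_self_sqrt (mul_nonneg hpos3.le hpos4)
  have hmulP : ∀ f, L (f * P) = L (f * e₄) - ρ * L (f * e₃) := by
    intro f
    rw [show f * P = f * e₄ - ρ • (f * e₃) by rw [hP, smul_eq_C_mul]; ring, map_sub, map_smul,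
      smul_eq_mul]
  have h3P : L (e₃ * P) = 0 := by
    rw [hmulP, mul_comm e₃ e₄, h43, h33, hρ, div_mul_cancel₀ _ hpos3.ne', sub_self]
  have h4P : L (e₄ * P) = 0 := by
    rw [hmulP, h43, h44, hρ, div_mul_eq_mul_div, hsq, mul_div_cancel_left₀ _ hpos3.ne', sub_self]
  have hPP : L (P * P) = 0 := by
    rw [show P * P = e₄ * P - ρ • (e₃ * P) by
      conv_lhs => rw [hP, sub_mul]
      rw [smul_eq_C_mul, ← hP]; ring, map_sub, map_smul, h3P, h4P, smul_zero, sub_zero]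
  have hlowP : ∀ f : ℝ[X], f.degree < (4 * n - 1 : ℕ) → L (f * P) = 0 := by
    intro f hf
    have hdeg : (f - C (f.coeff (4 * n - 2)) * e₃).degree < (4 * n - 2 : ℕ) := by
      refine (degree_lt_iff_coeff_zero _ _).mpr fun m hm => ?_
      rw [coeff_sub, coeff_C_mul, c₃ m hm]
      by_cases h : m = 4 * n - 2
      · subst h; simp
      · simp [h, (degree_lt_iff_coeff_zero _ _).mp hf m (by omega)]
    have h0 : L ((f - C (f.coeff (4 * n - 2)) * e₃) * P) = 0 := by
      rw [hmulP, hL, momentFunctional_mul_orthPoly_eq_zero hC2 hM2 ht hdeg,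
        momentFunctional_mul_orthPoly_eq_zero hC2 hM2 hs hdeg, mul_zero, sub_zero]
    rw [show f * P = (f - C (f.coeff (4 * n - 2)) * e₃) * P + f.coeff (4 * n - 2) • (e₃ * P) by
      rw [smul_eq_C_mul]; ring, map_add, map_smul, h0, h3P, smul_zero, add_zero]
  have hdecomp : ∀ f : ℝ[X], f.natDegree ≤ 4 * n → ∃ (f₀ : ℝ[X]) (a b : ℝ),
      f₀.degree < (4 * n - 1 : ℕ) ∧ f = f₀ + C a * e₅ + C b * P := by
    intro f hf
    refine ⟨f - C (f.coeff (4 * n - 1)) * e₅ - C (f.coeff (4 * n)) * P, f.coeff (4 * n - 1),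
      f.coeff (4 * n), ?_, by ring⟩
    refine (degree_lt_iff_coeff_zero _ _).mpr fun m hm => ?_
    rw [coeff_sub, coeff_sub, coeff_C_mul, coeff_C_mul, c₅ m hm, cP m hm]
    by_cases h1 : m = 4 * n - 1
    · subst h1; simp [show 4 * n - 1 ≠ 4 * n by omega]
    by_cases h2 : m = 4 * n
    · subst h2; simp [show 4 * n ≠ 4 * n - 1 by omega]
    simp [h1, h2, natDegree_le_iff_coeff_eq_zero.mp hf m (by omega)]
  have hker : ∀ f : ℝ[X], f.natDegree ≤ 4 * n → L (f * P) = 0 := by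
    intro f hf
    obtain ⟨f₀, a, b, hf₀, rfl⟩ := hdecomp f hf
    rw [show (f₀ + C a * e₅ + C b * P) * P = f₀ * P + a • (e₅ * P) + b • (P * P) by
      simp only [smul_eq_C_mul]; ring]
    simp [hlowP f₀ hf₀, h5P, hPP]
  refine ⟨g, P, fun p h5 h2 h1 => (hgg p h5 h2 h1).symm, hPmonic, hPdeg, fun f hf => ?_, hker⟩
  obtain ⟨f₀, a, b, hf₀, rfl⟩ := hdecomp f hf
  have o₅ : L (f₀ * e₅) = 0 := momentFunctional_mul_orthPoly_eq_zero hC4 hM4 hw hf₀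
  have h0 : 0 ≤ L (f₀ * f₀) := by
    by_cases h : f₀ = 0
    · simp [h]
    · exact (momentFunctional_mul_self_pos hC4 hM4 hf₀ h).le
  rw [← hL, show (f₀ + C a * e₅ + C b * P) * (f₀ + C a * e₅ + C b * P) = f₀ * f₀ +
      (2 * a) • (f₀ * e₅) + (2 * b) • (f₀ * P) + (a ^ 2) • (e₅ * e₅) +
      (2 * a * b) • (e₅ * P) + (b ^ 2) • (P * P) by
    simp only [smul_eq_C_mul, C_mul, C_pow, C_ofNat]; ring]
  simp only [map_add, map_smul, smul_eq_mul, o₅, hlowP f₀ hf₀, h5P, hPP, mul_zero, add_zero]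
  exact add_nonneg h0 (mul_nonneg (sq_nonneg a) h55)

/-- The column relations express every moment through `gamma4`. -/
theorem eq_gamma4_of_relations {n : ℕ} {β : ℕ → ℕ → ℝ}
    (hrel : ∀ i j : ℕ, i + j + 4 ≤ 2 * n → β (i + 4) j = β i (j + 1)) (i j : ℕ)
    (hij : i + j ≤ 2 * n) : β i j = gamma4 β (i + 4 * j) := by
  induction i using Nat.strong_induction_on generalizing j with
  | _ i ih =>
    by_cases h : i < 4
    · rw [gamma4]; congr 1 <;> omega
    · obtain ⟨k, rfl⟩ : ∃ k, i = k + 4 := ⟨i - 4, by omega⟩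
      rw [hrel k j (by omega), ih k (by omega) (j + 1) (by omega)]
      congr 1; ring

/-- A nonnegative combination of evaluations on the curve `y = x ^ 4` is a representing measure. -/
theorem isRepMeasure_sum_dirac {n : ℕ} {β : ℕ → ℕ → ℝ} {S : Finset ℝ} {w : ℝ → ℝ}
    (hw : ∀ a ∈ S, 0 ≤ w a)
    (h : ∀ i j, i + j ≤ 2 * n → β i j = ∑ a ∈ S, w a * a ^ (i + 4 * j)) :
    IsRepMeasure n β
      (∑ a ∈ S, ENNReal.ofReal (w a) • Measure.dirac ((a, a ^ 4) : ℝ × ℝ)) := by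
  intro i j hij
  have hint : ∀ a ∈ S, Integrable (fun p : ℝ × ℝ => p.1 ^ i * p.2 ^ j)
      (ENNReal.ofReal (w a) • Measure.dirac ((a, a ^ 4) : ℝ × ℝ)) := fun a _ =>
    (integrable_dirac enorm_lt_top).smul_measure ENNReal.ofReal_ne_top
  refine ⟨integrable_finsetSum_measure.mpr hint, ?_⟩
  rw [integral_finsetSum_measure hint, h i j hij]
  refine Finset.sum_congr rfl fun a ha => ?_
  rw [integral_smul_measure, integral_dirac, ENNReal.toReal_ofReal (hw a ha), smul_eq_mul, pow_add,
    pow_mul]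

/-- Sufficiency in the `(y − x⁴)`-pure truncated moment problem: if `C₂` is
positive definite, `C₃` is positive semidefinite, and there exists `A` with
`A₋ < A < A₊` such that `C₅[A]` is positive semidefinite and
`wᵀC₄[A]⁻¹w ≤ tᵀC₂⁻¹s + √((C₄[A]/C₂)(C₅[A]/C₂))`, then `C₄[A]` is positive
definite and `β` admits a representing measure. -/
theorem pure_y_eq_x4_sufficient (n : ℕ) (hn : 4 ≤ n)
    (β : ℕ → ℕ → ℝ) (hpure : IsPure n 4 β)
    (hC2 : (C2mat n β).PosDef) (hC3 : (C3mat n β).PosSemidef)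
    (A : ℝ) (hA1 : Aminus n β < A) (hA2 : A < Aplus n β)
    (hC5 : (C5mat n β A).PosSemidef)
    (hineq : wvec n β A ⬝ᵥ (C4mat n β A)⁻¹ *ᵥ wvec n β A ≤
      tvec n β A ⬝ᵥ (C2mat n β)⁻¹ *ᵥ svec n β A +
        Real.sqrt (schur4 n β A * schur5 n β A)) :
    (C4mat n β A).PosDef ∧ ∃ μ : Measure (ℝ × ℝ), IsRepMeasure n β μ := by
  obtain ⟨-, hrel, -, -⟩ := hpure
  have hC4 := C4mat_posDef hn hC2 hC3 hA1 hA2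
  refine ⟨hC4, ?_⟩
  obtain ⟨g, P, hg, hP, hdeg, hpos, hker⟩ := exists_completion hn hC2 hC4 hC5 hineq
  obtain ⟨S, w, hw, hL⟩ := exists_eq_sum_eval_of_natDegree_le hP hdeg hpos hker
  refine ⟨_, isRepMeasure_sum_dirac hw fun i j hij => ?_⟩
  have h := hL (X ^ (i + 4 * j)) (by rw [natDegree_X_pow]; omega)
  rw [momentFunctional_X_pow, hg _ (by omega) (by omega) (by omega)] at h
  rw [eq_gamma4_of_relations hrel i j hij, h]
  simp
end
end

section
/- Let m ≥ 3 be an integer. Let A₁ be a real symmetric positive definite (m−2)×(m−2) matrix, let a, b ∈ ℝ^{m−2} and α, β ∈ ℝ, and for x ∈ ℝ let A(x) be the m×m real symmetric matrix with block form [[A₁, a, b],[aᵀ, α, x],[bᵀ, x, β]]. Assume that A₂ := [[A₁, a],[aᵀ, α]] and A₃ := [[A₁, b],[bᵀ, β]] are positive semidefinite, and set x_± := bᵀ A₁⁻¹ a ± √((A₂/A₁)(A₃/A₁)). Then: (1) for x₀ ∈ ℝ, the matrix A(x₀) is positive semidefinite if and only if x₋ ≤ x₀ ≤ x₊; (2)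 if x₀ ∈ {x₋, x₊}, then rank A(x₀) = max(rank A₂, rank A₃); (3) if x₋ < x₀ < x₊, then rank A(x₀) = max(rank A₂, rank A₃) + 1. -/
open Matrix

noncomputable section

/-- The bordered matrix `[[A₁, a],[aᵀ, α]]`. -/
def border1 {k : ℕ} (A₁ : Matrix (Fin k) (Fin k) ℝ) (a : Fin k → ℝ) (α : ℝ) :
    Matrix (Fin k ⊕ Fin 1) (Fin k ⊕ Fin 1) ℝ :=
  Matrix.fromBlocks A₁ (Matrix.of fun i _ => a i) (Matrix.of fun _ j => a j)
    (Matrix.of fun _ _ => α)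

/-- The doubly bordered matrix `A(x) = [[A₁, a, b],[aᵀ, α, x],[bᵀ, x, β]]`. -/
def border2 {k : ℕ} (A₁ : Matrix (Fin k) (Fin k) ℝ) (a b : Fin k → ℝ)
    (α β x : ℝ) : Matrix (Fin k ⊕ Fin 2) (Fin k ⊕ Fin 2) ℝ :=
  Matrix.fromBlocks A₁
    (Matrix.of fun i j => if j = 0 then a i else b i)
    (Matrix.of fun i j => if i = 0 then a j else b j)
    (Matrix.of fun i j =>
      if i = 0 then (if j = 0 then α else x) else (if j = 0 then x else β))

/-- The kernel of a block matrix with invertible top-left block is the kernel of its Schur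
complement. -/
def kerFromBlocksEquiv {K l m n : Type*} [Field K] [Fintype m] [DecidableEq m] [Fintype n]
    (A : Matrix m m K) (B : Matrix m n K) (C : Matrix l m K) (D : Matrix l n K)
    (hA : IsUnit A.det) :
    LinearMap.ker (fromBlocks A B C D).mulVecLin ≃ₗ[K]
      LinearMap.ker (D - C * A⁻¹ * B).mulVecLin where
  toFun v := ⟨v.1 ∘ Sum.inr, by
    have hv := v.2
    rw [LinearMap.mem_ker, mulVecLin_apply, fromBlocks_mulVec] at hv
    have h₁ : A *ᵥ (v.1 ∘ Sum.inl) + B *ᵥ (v.1 ∘ Sum.inr) = 0 :=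
      funext fun i => congrFun hv (Sum.inl i)
    have h₂ : C *ᵥ (v.1 ∘ Sum.inl) + D *ᵥ (v.1 ∘ Sum.inr) = 0 :=
      funext fun i => congrFun hv (Sum.inr i)
    rw [LinearMap.mem_ker, mulVecLin_apply, sub_mulVec, ← mulVec_mulVec,
      eq_neg_of_add_eq_zero_right h₁, mulVec_neg, mulVec_mulVec, nonsing_inv_mul_cancel_right _ _ hA,
      sub_neg_eq_add, add_comm, h₂]⟩
  invFun w := ⟨Sum.elim (-(A⁻¹ * B) *ᵥ w.1) w.1, by
    have hw := w.2
    rw [LinearMap.mem_ker, mulVecLin_apply] at hw ⊢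
    rw [fromBlocks_mulVec, Sum.elim_comp_inl, Sum.elim_comp_inr, mulVec_mulVec, mulVec_mulVec,
      ← add_mulVec, ← add_mulVec, Matrix.mul_neg, Matrix.mul_neg,
      mul_nonsing_inv_cancel_left _ _ hA, neg_add_cancel, zero_mulVec, neg_add_eq_sub,
      ← Matrix.mul_assoc, hw]
    exact Sum.elim_const_const _⟩
  map_add' _ _ := rfl
  map_smul' _ _ := rfl
  left_inv v := by
    have hv := v.2
    rw [LinearMap.mem_ker, mulVecLin_apply, fromBlocks_mulVec] at hv
    have h₁ : A *ᵥ (v.1 ∘ Sum.inl) + B *ᵥ (v.1 ∘ Sum.inr) = 0 :=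
      funext fun i => congrFun hv (Sum.inl i)
    ext i
    rcases i with i | i
    · have h : -(A⁻¹ * B) *ᵥ (v.1 ∘ Sum.inr) = v.1 ∘ Sum.inl := by
        rw [neg_mulVec, ← mulVec_mulVec, eq_neg_of_add_eq_zero_right h₁, mulVec_neg, neg_neg,
          mulVec_mulVec, nonsing_inv_mul _ hA, one_mulVec]
      exact congrFun h i
    · rfl
  right_inv _ := rfl

/-- **Guttman rank additivity**. -/
theorem rank_fromBlocks_of_isUnit_det {K l m n : Type*} [Field K] [Fintype m] [DecidableEq m]
    [Fintype n] (A : Matrix m m K) (B : Matrix m n K) (C : Matrix l m K) (D : Matrix l n K)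
    (hA : IsUnit A.det) :
    (fromBlocks A B C D).rank = Fintype.card m + (D - C * A⁻¹ * B).rank := by
  have h₁ := (fromBlocks A B C D).mulVecLin.finrank_range_add_finrank_ker
  have h₂ := (D - C * A⁻¹ * B).mulVecLin.finrank_range_add_finrank_ker
  have h₃ := (kerFromBlocksEquiv A B C D hA).finrank_eq
  simp only [Module.finrank_fintype_fun_eq_card, Fintype.card_sum] at h₁ h₂
  unfold Matrix.rank
  omega

theorem rank_of_const_fin_one {K : Type*} [Field K] [DecidableEq K] (p : K) :
    (Matrix.of fun _ _ : Fin 1 => p).rank = if p = 0 then 0 else 1 := by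
  split_ifs with hp
  · subst hp
    exact rank_zero
  · rw [rank_of_det_ne_zero (by simpa using hp), Fintype.card_fin]

theorem rank_fin_two_of_det_ne_zero {K : Type*} [Field K] {p q y : K} (h : p * q ≠ y * y) :
    !![p, y; y, q].rank = 2 := by
  rw [rank_of_det_ne_zero (by rwa [det_fin_two_of, sub_ne_zero]), Fintype.card_fin]

theorem rank_fin_two_of_det_eq_zero {K : Type*} [Field K] [DecidableEq K] {p q y : K}
    (h : p * q = y * y) :
    !![p, y; y, q].rank = max (if p = 0 then 0 else 1) (if q = 0 then 0 else 1) := by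
  have rank_one {M : Matrix (Fin 2) (Fin 2) K} {u v : Fin 2 → K} (hM : M = vecMulVec u v)
      (h0 : M ≠ 0) : M.rank = 1 := by
    have h₁ : M.rank ≤ 1 := hM ▸ rank_vecMulVec_le u v
    have h₂ : M.rank ≠ 0 := fun h => h0 (by
      rw [Matrix.rank, Submodule.finrank_eq_zero, LinearMap.range_eq_bot] at h
      exact Matrix.toLin'.injective (by simpa [Matrix.toLin'_apply'] using h))
    omega
  by_cases hp : p = 0
  · have hy : y = 0 := by simpa [hp, eq_comm] using h
    by_cases hq : q = 0
    · have : !![p, y; y, q] = 0 := by ext i j; fin_cases i <;> fin_cases j <;> simp [hp, hq, hy]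
      rw [this, rank_zero, if_pos hp, if_pos hq, max_self]
    · rw [rank_one (u := ![0, 1]) (v := ![0, q])]
      · rw [if_pos hp, if_neg hq, max_eq_right zero_le_one]
      · ext i j; fin_cases i <;> fin_cases j <;> simp [vecMulVec_apply, hp, hy]
      · exact fun h0 => hq (by simpa using congrFun (congrFun h0 1) 1)
  · rw [rank_one (u := ![p, y]) (v := ![1, y / p])]
    · simp only [hp, if_false]
      split_ifs <;> rfl
    · ext i j
      fin_cases i <;> fin_cases j <;> simp [vecMulVec_apply]
      · field_simp
      · field_simp; linear_combination h
    · exact fun h0 => hp (by simpa using congrFun (congrFun h0 0) 0)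

theorem posSemidef_fin_two_iff {p q y : ℝ} (hp : 0 ≤ p) (hq : 0 ≤ q) :
    !![p, y; y, q].PosSemidef ↔ y ^ 2 ≤ p * q := by
  constructor
  · intro h
    have := h.det_nonneg
    rw [det_fin_two_of] at this
    linarith [sq y]
  · intro h
    refine .of_dotProduct_mulVec_nonneg ?_ fun x => ?_
    · ext i j; fin_cases i <;> fin_cases j <;> simp
    · suffices 0 ≤ x 0 * (p * x 0 + y * x 1) + x 1 * (y * x 0 + q * x 1) by
        simpa [dotProduct, mulVec, Fin.sum_univ_two] using this
      rcases hp.eq_or_lt with rfl | hp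
      · have hy : y = 0 := by nlinarith
        subst hy
        nlinarith [mul_nonneg hq (sq_nonneg (x 1))]
      · refine nonneg_of_mul_nonneg_right (a := p) ?_ hp
        nlinarith [sq_nonneg (p * x 0 + y * x 1), mul_nonneg (sub_nonneg.2 h) (sq_nonneg (x 1))]

theorem border1_schur {k : ℕ} (A : Matrix (Fin k) (Fin k) ℝ) (a : Fin k → ℝ) (α : ℝ) :
    (Matrix.of fun _ _ => α) - (Matrix.of fun _ j => a j) * A⁻¹ * (Matrix.of fun i _ => a i) =
      (Matrix.of fun _ _ : Fin 1 => α - a ⬝ᵥ A⁻¹ *ᵥ a) := by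
  ext i j
  rw [Matrix.mul_assoc]
  rfl

theorem border2_schur {k : ℕ} {A : Matrix (Fin k) (Fin k) ℝ} (hA : A.IsHermitian)
    (a b : Fin k → ℝ) (α β x : ℝ) :
    (Matrix.of fun i j : Fin 2 =>
        if i = 0 then (if j = 0 then α else x) else (if j = 0 then x else β)) -
      (Matrix.of fun (i : Fin 2) j => if i = 0 then a j else b j) * A⁻¹ *
        (Matrix.of fun i (j : Fin 2) => if j = 0 then a i else b i) =
      !![α - a ⬝ᵥ A⁻¹ *ᵥ a, x - b ⬝ᵥ A⁻¹ *ᵥ a; x - b ⬝ᵥ A⁻¹ *ᵥ a, β - b ⬝ᵥ A⁻¹ *ᵥ b] := by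
  have hab : a ⬝ᵥ A⁻¹ *ᵥ b = b ⬝ᵥ A⁻¹ *ᵥ a := by
    have hT : (A⁻¹)ᵀ = A⁻¹ := by simpa using hA.inv.eq
    rw [dotProduct_mulVec, ← mulVec_transpose, hT, dotProduct_comm]
  rw [Matrix.mul_assoc]
  ext i j
  fin_cases i <;> fin_cases j
  · rfl
  · exact congrArg (x - ·) hab
  · rfl
  · rfl

theorem rank_border1 {k : ℕ} {A : Matrix (Fin k) (Fin k) ℝ} (hA : A.PosDef) (a : Fin k → ℝ)
    (α : ℝ) :
    (border1 A a α).rank = k + if α - a ⬝ᵥ A⁻¹ *ᵥ a = 0 then 0 else 1 := by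
  rw [border1, rank_fromBlocks_of_isUnit_det _ _ _ _ hA.det_pos.ne'.isUnit, border1_schur,
    rank_of_const_fin_one, Fintype.card_fin]

theorem rank_border2 {k : ℕ} {A : Matrix (Fin k) (Fin k) ℝ} (hA : A.PosDef) (a b : Fin k → ℝ)
    (α β x : ℝ) :
    (border2 A a b α β x).rank = k +
      !![α - a ⬝ᵥ A⁻¹ *ᵥ a, x - b ⬝ᵥ A⁻¹ *ᵥ a;
        x - b ⬝ᵥ A⁻¹ *ᵥ a, β - b ⬝ᵥ A⁻¹ *ᵥ b].rank := by
  rw [border2, rank_fromBlocks_of_isUnit_det _ _ _ _ hA.det_pos.ne'.isUnit,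
    border2_schur hA.isHermitian, Fintype.card_fin]

theorem schur_nonneg_of_posSemidef_border1 {k : ℕ} {A : Matrix (Fin k) (Fin k) ℝ}
    (hA : A.PosDef) {a : Fin k → ℝ} {α : ℝ} (h : (border1 A a α).PosSemidef) :
    0 ≤ α - a ⬝ᵥ A⁻¹ *ᵥ a := by
  let := A.invertibleOfIsUnitDet hA.det_pos.ne'.isUnit
  have h' := (PosDef.fromBlocks₁₁ (Matrix.of fun i (_ : Fin 1) => a i)
    (Matrix.of fun _ _ => α) hA).1 h
  exact (border1_schur A a α ▸ h' :
    (Matrix.of fun _ _ : Fin 1 => α - a ⬝ᵥ A⁻¹ *ᵥ a).PosSemidef).diag_nonneg (i := 0)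

theorem posSemidef_border2_iff {k : ℕ} {A : Matrix (Fin k) (Fin k) ℝ} (hA : A.PosDef)
    (a b : Fin k → ℝ) (α β x : ℝ) :
    (border2 A a b α β x).PosSemidef ↔
      !![α - a ⬝ᵥ A⁻¹ *ᵥ a, x - b ⬝ᵥ A⁻¹ *ᵥ a;
        x - b ⬝ᵥ A⁻¹ *ᵥ a, β - b ⬝ᵥ A⁻¹ *ᵥ b].PosSemidef := by
  let := A.invertibleOfIsUnitDet hA.det_pos.ne'.isUnit
  rw [← border2_schur hA.isHermitian]
  exact PosDef.fromBlocks₁₁ (Matrix.of fun i (j : Fin 2) => if j = 0 then a i else b i)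
    (Matrix.of fun i j : Fin 2 =>
      if i = 0 then (if j = 0 then α else x) else (if j = 0 then x else β)) hA

/-- Positive semidefinite completion of a partially defined Hankel-type matrix
with one unknown entry: with `x_± = bᵀA₁⁻¹a ± √((A₂/A₁)(A₃/A₁))`,
(1) `A(x₀)` is positive semidefinite iff `x₋ ≤ x₀ ≤ x₊`;
(2) if `x₀ ∈ {x₋, x₊}` then `rank A(x₀) = max (rank A₂) (rank A₃)`;
(3) if `x₋ < x₀ < x₊` then `rank A(x₀) = max (rank A₂) (rank A₃) + 1`. -/
theorem posSemidef_completion_one_missing (m : ℕ) (hm : 3 ≤ m)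
    (A₁ : Matrix (Fin (m - 2)) (Fin (m - 2)) ℝ) (hA₁ : A₁.PosDef)
    (a b : Fin (m - 2) → ℝ) (α β : ℝ)
    (hA₂ : (border1 A₁ a α).PosSemidef) (hA₃ : (border1 A₁ b β).PosSemidef) :
    (∀ x₀ : ℝ, (border2 A₁ a b α β x₀).PosSemidef ↔
      (b ⬝ᵥ A₁⁻¹ *ᵥ a -
          Real.sqrt ((α - a ⬝ᵥ A₁⁻¹ *ᵥ a) * (β - b ⬝ᵥ A₁⁻¹ *ᵥ b)) ≤ x₀ ∧
        x₀ ≤ b ⬝ᵥ A₁⁻¹ *ᵥ a +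
          Real.sqrt ((α - a ⬝ᵥ A₁⁻¹ *ᵥ a) * (β - b ⬝ᵥ A₁⁻¹ *ᵥ b)))) ∧
    (∀ x₀ : ℝ,
      (x₀ = b ⬝ᵥ A₁⁻¹ *ᵥ a -
          Real.sqrt ((α - a ⬝ᵥ A₁⁻¹ *ᵥ a) * (β - b ⬝ᵥ A₁⁻¹ *ᵥ b)) ∨
        x₀ = b ⬝ᵥ A₁⁻¹ *ᵥ a +
          Real.sqrt ((α - a ⬝ᵥ A₁⁻¹ *ᵥ a) * (β - b ⬝ᵥ A₁⁻¹ *ᵥ b))) →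
      (border2 A₁ a b α β x₀).rank =
        max (border1 A₁ a α).rank (border1 A₁ b β).rank) ∧
    (∀ x₀ : ℝ,
      b ⬝ᵥ A₁⁻¹ *ᵥ a -
          Real.sqrt ((α - a ⬝ᵥ A₁⁻¹ *ᵥ a) * (β - b ⬝ᵥ A₁⁻¹ *ᵥ b)) < x₀ →
      x₀ < b ⬝ᵥ A₁⁻¹ *ᵥ a +
          Real.sqrt ((α - a ⬝ᵥ A₁⁻¹ *ᵥ a) * (β - b ⬝ᵥ A₁⁻¹ *ᵥ b)) →
      (border2 A₁ a b α β x₀).rank =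
        max (border1 A₁ a α).rank (border1 A₁ b β).rank + 1) := by
  have hp := schur_nonneg_of_posSemidef_border1 hA₁ hA₂
  have hq := schur_nonneg_of_posSemidef_border1 hA₁ hA₃
  simp only [posSemidef_border2_iff hA₁, posSemidef_fin_two_iff hp hq, rank_border1 hA₁,
    rank_border2 hA₁]
  generalize α - a ⬝ᵥ A₁⁻¹ *ᵥ a = p at *
  generalize β - b ⬝ᵥ A₁⁻¹ *ᵥ b = q at *
  generalize b ⬝ᵥ A₁⁻¹ *ᵥ a = c at *
  have hs := Real.sq_sqrt (mul_nonneg hp hq)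
  refine ⟨fun x => ?_, fun x hx => ?_, fun x hx₁ hx₂ => ?_⟩
  · rw [Real.sq_le (mul_nonneg hp hq), neg_le_sub_iff_le_add, sub_le_iff_le_add,
      sub_le_iff_le_add, add_comm (√(p * q)) c]
  · rw [rank_fin_two_of_det_eq_zero, Nat.add_max_add_left]
    rcases hx with rfl | rfl <;> linear_combination -hs
  · have hlt : (x - c) ^ 2 < p * q := by
      rw [Real.sq_lt]
      constructor <;> linarith
    have hpq : 0 < p * q := (sq_nonneg _).trans_lt hlt
    rw [rank_fin_two_of_det_ne_zero (by rw [← sq]; exact hlt.ne'),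
      if_neg (left_ne_zero_of_mul hpq.ne'), if_neg (right_ne_zero_of_mul hpq.ne'), max_self]
end
end

section
/- Let n ≥ d ≥ 1 be integers and let β be a bivariate sequence of degree 2n such that M_n(β) is positive semidefinite and (y−x^d)-pure. Then rank M_n(β) = rank M̂_n(β) = d(2n−d+3)/2. -/
open MeasureTheory Matrix

noncomputable section

/-- Iterating the `(y − x^d)` column relations trades `x^(d q)` for `y^q`. -/
theorem beta_reduce {n d : ℕ} {β : ℕ → ℕ → ℝ} (hd : 1 ≤ d)
    (h : ∀ i j : ℕ, i + j + d ≤ 2 * n → β (i + d) j = β i (j + 1)) (q : ℕ) :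
    ∀ i j : ℕ, i + d * q + j ≤ 2 * n → β (i + d * q) j = β i (j + q) := by
  induction q with
  | zero => simp
  | succ q ih =>
    intro i j hij
    have hq : q ≤ d * q := Nat.le_mul_of_pos_left q hd
    rw [Nat.mul_succ] at hij ⊢
    rw [← add_assoc, h (i + d * q) j (by omega), ih i (j + 1) (by omega)]
    congr 1
    omega

/-- The reduction of the monomial `x^i y^j` modulo `y − x^d`. -/
def reduceIdx (n d : ℕ) (hd : 1 ≤ d) (p : MomIdx n) : MomIdxHat n d :=
  have hlt : (p.1.1 : ℕ) % d < d := Nat.mod_lt _ hd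
  have hle : (p.1.1 : ℕ) % d + ((p.1.2 : ℕ) + (p.1.1 : ℕ) / d) ≤ n := by
    have h₁ := Nat.mod_add_div (p.1.1 : ℕ) d
    have h₂ : (p.1.1 : ℕ) / d ≤ d * ((p.1.1 : ℕ) / d) := Nat.le_mul_of_pos_left _ hd
    have h₃ := p.2
    omega
  ⟨(⟨(p.1.1 : ℕ) % d, Nat.lt_succ_of_le (le_of_add_le_left hle)⟩,
    ⟨(p.1.2 : ℕ) + (p.1.1 : ℕ) / d, Nat.lt_succ_of_le (le_of_add_le_right hle)⟩), hle, hlt⟩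

theorem momentMatrix_eq_submatrix_hat {n d : ℕ} {β : ℕ → ℕ → ℝ} (hd : 1 ≤ d)
    (h : ∀ i j : ℕ, i + j + d ≤ 2 * n → β (i + d) j = β i (j + 1)) :
    momentMatrix n β =
      (momentMatrixHat n d β).submatrix (reduceIdx n d hd) (reduceIdx n d hd) := by
  ext ⟨⟨⟨i, hi⟩, ⟨j, hj⟩⟩, hij⟩ ⟨⟨⟨k, hk⟩, ⟨l, hl⟩⟩, hkl⟩
  simp only [momentMatrix, momentMatrixHat, reduceIdx, Matrix.of_apply, Matrix.submatrix_apply]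
    at hij hkl ⊢
  have hi' := Nat.mod_add_div i d
  have hk' := Nat.mod_add_div k d
  have hsum : i % d + k % d + d * (i / d + k / d) = i + k := by rw [mul_add]; omega
  have key := beta_reduce hd h (i / d + k / d) (i % d + k % d) (j + l) (by omega)
  rw [hsum] at key
  rw [key]
  congr 1
  omega

theorem momentMatrixHat_eq_submatrix (n d : ℕ) (β : ℕ → ℕ → ℝ) :
    momentMatrixHat n d β =
      (momentMatrix n β).submatrix (fun p => ⟨p.1, p.2.1⟩) (fun p => ⟨p.1, p.2.1⟩) :=
  rfl

theorem card_momIdxHat {n d : ℕ} (hdn : d ≤ n) :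
    Fintype.card (MomIdxHat n d) = d * (2 * n - d + 3) / 2 := by
  have e : MomIdxHat n d ≃ (i : Fin d) × Fin (n + 1 - i) :=
    { toFun := fun p => ⟨⟨p.1.1, p.2.2⟩, ⟨p.1.2, by have := p.2.1; simp only; omega⟩⟩
      invFun := fun s => ⟨(⟨s.1, by omega⟩, ⟨s.2, by omega⟩), by
        have := s.2.2
        simp only
        omega, s.1.2⟩
      left_inv := fun _ => rfl
      right_inv := fun _ => rfl }
  have hsum : ∀ m ≤ n, (∑ i ∈ Finset.range m, (n + 1 - i)) * 2 = m * (2 * n - m + 3) := by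
    intro m
    induction m with
    | zero => simp
    | succ m ih =>
      intro hm
      rw [Finset.sum_range_succ, add_mul, ih (by omega)]
      obtain ⟨c, rfl⟩ := Nat.exists_eq_add_of_le hm
      rw [show 2 * (m + 1 + c) - m + 3 = m + 2 * c + 5 by omega,
        show m + 1 + c + 1 - m = c + 2 by omega,
        show 2 * (m + 1 + c) - (m + 1) + 3 = m + 2 * c + 4 by omega]
      ring
  rw [Fintype.card_congr e, Fintype.card_sigma]
  simp only [Fintype.card_fin]
  rw [Fin.sum_univ_eq_sum_range (fun i => n + 1 - i) d, ← hsum d hdn]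
  omega

/-- If `M_n(β)` is positive semidefinite and `(y − x^d)`-pure, then
`rank M_n(β) = rank M̂_n(β) = d(2n − d + 3)/2`. -/
theorem pure_rank (n d : ℕ) (hd : 1 ≤ d) (hdn : d ≤ n)
    (β : ℕ → ℕ → ℝ) (hpure : IsPure n d β) :
    (momentMatrix n β).rank = d * (2 * n - d + 3) / 2 ∧
    (momentMatrixHat n d β).rank = d * (2 * n - d + 3) / 2 := by
  obtain ⟨-, hrel, -, hpos⟩ := hpure
  have hhat : (momentMatrixHat n d β).rank = d * (2 * n - d + 3) / 2 := by
    rw [Matrix.rank_of_isUnit _ hpos.isUnit, card_momIdxHat hdn]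
  refine ⟨le_antisymm ?_ ?_, hhat⟩
  · rw [← hhat, momentMatrix_eq_submatrix_hat hd hrel]
    exact Matrix.rank_submatrix_le _ _ _
  · rw [← hhat, momentMatrixHat_eq_submatrix]
    exact Matrix.rank_submatrix_le _ _ _
end
end
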